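/- Let k be a field of characteristic zero and let P, Q ∈ k[x,y] be relatively prime polynomials with Q ≠ 0. Embed the rational function field k(x,y) into the iterated Laurent series field k((x⁻¹))((y⁻¹)) by Laurent expansion at infinity (first in y, then coefficient-wise in x). Suppose the expansion of P/Q lies in k[x]((y⁻¹)), i.e. writing P/Q = ∑_{j ≤ N} c_j·y^j all coefficients c_j are polynomials in x, and suppose it satisfies condition A₁: there exists m ∈ ℤ such that deg_x(c_j) + j ≤ m for all j. Then, writing Q = ∑_{l=0}^n q_l(x)·y^l with q_n ≠ 0, the leading coefficient q_n is a nonzero constant in k and n equals the total degree of Q. -/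

import Mathlib

noncomputable section

variable (k : Type) [Field k] [CharZero k]

/-- `k((x⁻¹))`: Laurent series in `X = x⁻¹`. -/
abbrev Kx := LaurentSeries k

/-- `k((x⁻¹))((y⁻¹))`: Laurent series in `Y = y⁻¹` over `k((x⁻¹))`. -/
abbrev Kxy := LaurentSeries (Kx k)

/-- the element `x = X⁻¹ ∈ k((x⁻¹))`. -/
def xInner : Kx k := HahnSeries.single (-1 : ℤ) (1 : k)

/-- the element `x ∈ k((x⁻¹))((y⁻¹))`. -/
def xElem : Kxy k := HahnSeries.C (xInner k)

/-- the element `y = Y⁻¹ ∈ k((x⁻¹))((y⁻¹))`. -/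
def yElem : Kxy k := HahnSeries.single (-1 : ℤ) (1 : Kx k)

/-- Laurent expansion at infinity of a polynomial in `k[x,y]`
(first in `y`, then coefficient-wise in `x`). -/
def expand : MvPolynomial (Fin 2) k →ₐ[k] Kxy k :=
  MvPolynomial.aeval ![xElem k, yElem k]

/-- the embedding `k[x] → k((x⁻¹))`. -/
def polyX : Polynomial k →ₐ[k] Kx k := Polynomial.aeval (xInner k)

open Polynomial in
theorem exists_mul_add_mul_eq_C {R : Type*} [CommRing R] [IsDomain R] [IsGCDMonoid R]
    {p q : R[X]} (hp : p ≠ 0) (h : ∀ r : R[X], r ∣ p → r ∣ q → IsUnit r) :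
    ∃ a b : R[X], ∃ r : R, r ≠ 0 ∧ a * p + b * q = C r := by
  classical
  let := Classical.arbitrary (NormalizedGCDMonoid R)
  let K := FractionRing R
  have hinj : Function.Injective (algebraMap R K) := IsFractionRing.injective R K
  have key (f : K[X]) : ∃ g : R[X], ∃ b : R, b ≠ 0 ∧
      g.map (algebraMap R K) = C (algebraMap R K b) * f := by
    obtain ⟨b, hbmem, hb⟩ := IsLocalization.integerNormalization_spec (nonZeroDivisors R) f
    refine ⟨_, b, nonZeroDivisors.ne_zero hbmem, hb.trans ?_⟩
    rw [← algebraMap_smul K, Polynomial.smul_eq_C_mul]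
  set P := p.map (algebraMap R K)
  set Q := q.map (algebraMap R K)
  have hP : P ≠ 0 := (Polynomial.map_ne_zero_iff hinj).2 hp
  have hco : IsCoprime P Q := by
    rw [← EuclideanDomain.gcd_isUnit_iff]
    set d := EuclideanDomain.gcd P Q
    have hd : d ≠ 0 := fun h0 => hP (EuclideanDomain.gcd_eq_zero_iff.1 h0).1
    obtain ⟨g, b, hb, hg⟩ := key d
    have hbu : IsUnit (C (algebraMap R K b)) :=
      Polynomial.isUnit_C.2 (((map_ne_zero_iff _ hinj).2 hb).isUnit)
    have hg0 : g ≠ 0 := by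
      rintro rfl
      rw [Polynomial.map_zero] at hg
      exact mul_ne_zero hbu.ne_zero hd hg.symm
    have hcu : IsUnit (C (algebraMap R K g.content)) :=
      Polynomial.isUnit_C.2 (((map_ne_zero_iff _ hinj).2
        (mt Polynomial.content_eq_zero_iff.1 hg0)).isUnit)
    have hass : C (algebraMap R K g.content) * g.primPart.map (algebraMap R K)
        = C (algebraMap R K b) * d := by
      rw [← hg]
      conv_rhs => rw [g.eq_C_content_mul_primPart]
      simp
    have hdvd : g.primPart.map (algebraMap R K) ∣ d := by
      rw [← hbu.dvd_mul_left, ← hass]; exact dvd_mul_left _ _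
    have hdvd' : d ∣ g.primPart.map (algebraMap R K) := by
      rw [← hcu.dvd_mul_left, hass]; exact dvd_mul_left _ _
    have hu := h g.primPart
      (g.isPrimitive_primPart.dvd_of_fraction_map_dvd_fraction_map (K := K)
        (hdvd.trans (EuclideanDomain.gcd_dvd_left _ _)))
      (g.isPrimitive_primPart.dvd_of_fraction_map_dvd_fraction_map (K := K)
        (hdvd.trans (EuclideanDomain.gcd_dvd_right _ _)))
    exact isUnit_of_dvd_unit hdvd' (hu.map (Polynomial.mapRingHom (algebraMap R K)))
  obtain ⟨u, v, huv⟩ := hco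
  obtain ⟨a, r, hr, ha⟩ := key u
  obtain ⟨b, s, hs, hb⟩ := key v
  refine ⟨C s * a, C r * b, r * s, mul_ne_zero hr hs, Polynomial.map_injective _ hinj ?_⟩
  simp only [Polynomial.map_add, Polynomial.map_mul, Polynomial.map_C, ha, hb, map_mul]
  linear_combination (C (algebraMap R K r) * C (algebraMap R K s)) * huv

open PowerSeries in
theorem PowerSeries.C_dvd_iff_forall_dvd_coeff {R : Type*} [CommRing R] {p : R}
    {f : PowerSeries R} : C p ∣ f ↔ ∀ n, p ∣ coeff n f := by
  constructor
  · rintro ⟨g, rfl⟩ n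
    simp
  · intro h
    choose g hg using h
    exact ⟨mk g, by ext n; simp [hg]⟩

open PowerSeries in
theorem PowerSeries.C_dvd_or_dvd {R : Type*} [CommRing R] {p : R} (hp : Prime p)
    {f g : PowerSeries R} (h : C p ∣ f * g) : C p ∣ f ∨ C p ∣ g := by
  have hP : (Ideal.span {p}).IsPrime := (Ideal.span_singleton_prime hp.ne_zero).2 hp
  have key (f : PowerSeries R) :
      C p ∣ f ↔ PowerSeries.map (Ideal.Quotient.mk (Ideal.span {p})) f = 0 := by
    rw [PowerSeries.C_dvd_iff_forall_dvd_coeff, PowerSeries.ext_iff]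
    simp [Ideal.Quotient.eq_zero_iff_mem, Ideal.mem_span_singleton]
  rw [key, map_mul, mul_eq_zero] at h
  simpa [key] using h

open PowerSeries in
/-- Power series whose `s`-th coefficient is a polynomial of degree at most `s`. -/
def degreeBounded (F : Type*) [Field F] : Subring (PowerSeries (Polynomial F)) where
  carrier := {f | ∀ s, (coeff s f).natDegree ≤ s}
  mul_mem' {f g} hf hg s := by
    rw [coeff_mul]
    refine Polynomial.natDegree_sum_le_of_forall_le _ _ fun ij hij => ?_
    rw [← Finset.HasAntidiagonal.mem_antidiagonal.1 hij]
    exact Polynomial.natDegree_mul_le.trans (add_le_add (hf _) (hg _))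
  one_mem' s := by
    rw [coeff_one]; split_ifs <;> simp
  add_mem' {f g} hf hg s := by
    rw [map_add]
    exact (Polynomial.natDegree_add_le _ _).trans (max_le (hf s) (hg s))
  zero_mem' s := by simp
  neg_mem' {f} hf s := by simpa using hf s

open PowerSeries in
/-- The part of top degree: `∑ aₛ Yˢ ↦ ∑ (coefficient of xˢ in aₛ) tˢ`. -/
def topPart {F : Type*} [Field F] (f : PowerSeries (Polynomial F)) : PowerSeries F :=
  mk fun s => (coeff s f).coeff s

open PowerSeries in
theorem topPart_mul {F : Type*} [Field F] {f g : PowerSeries (Polynomial F)}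
    (hf : f ∈ degreeBounded F) (hg : g ∈ degreeBounded F) :
    topPart (f * g) = topPart f * topPart g := by
  ext s
  simp only [topPart, coeff_mk, coeff_mul, Polynomial.finsetSum_coeff]
  refine Finset.sum_congr rfl fun ij hij => ?_
  rw [← Finset.HasAntidiagonal.mem_antidiagonal.1 hij]
  exact Polynomial.coeff_mul_add_eq_of_natDegree_le (hf _) (hg _)

open PowerSeries in
theorem exists_eq_X_mul_of_topPart_eq_zero {F : Type*} [Field F] {f : PowerSeries (Polynomial F)}
    (hf : f ∈ degreeBounded F) (h : topPart f = 0) :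
    ∃ g ∈ degreeBounded F, f = X * g := by
  have h' (s : ℕ) : (coeff s f).coeff s = 0 := by
    simpa [topPart] using congrArg (coeff s) h
  have h0 : X ∣ f := by
    rw [X_dvd_iff, ← coeff_zero_eq_constantCoeff_apply,
      Polynomial.eq_C_of_natDegree_le_zero (hf 0), h' 0, Polynomial.C_0]
  obtain ⟨g, rfl⟩ := h0
  refine ⟨g, fun s => ?_, rfl⟩
  have h1 := hf (s + 1)
  have h2 := h' (s + 1)
  rw [coeff_succ_X_mul] at h1 h2
  rw [Polynomial.natDegree_le_iff_coeff_eq_zero] at h1 ⊢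
  intro N hN
  rcases eq_or_lt_of_le (Nat.succ_le_of_lt hN) with rfl | h3
  · exact h2
  · exact h1 N h3

open PowerSeries in
theorem isUnit_coeff_zero_of_mul_eq_X_pow {F : Type*} [Field F] {f : PowerSeries (Polynomial F)}
    (hf : f ∈ degreeBounded F) (hf0 : topPart f ≠ 0) (N : ℕ) :
    ∀ g ∈ degreeBounded F, f * g = X ^ N → IsUnit (coeff 0 f) := by
  induction N with
  | zero =>
    intro g _ h
    rw [coeff_zero_eq_constantCoeff_apply]
    exact (IsUnit.of_mul_eq_one g (by simpa using h)).map constantCoeff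
  | succ N ih =>
    intro g hg h
    have h0 : topPart f * topPart g = 0 := by
      rw [← topPart_mul hf hg, h]
      ext s
      by_cases hs : s = N + 1 <;> simp [topPart, coeff_X_pow, hs, Polynomial.coeff_one]
    obtain ⟨g', hg', rfl⟩ :=
      exists_eq_X_mul_of_topPart_eq_zero hg ((mul_eq_zero.1 h0).resolve_left hf0)
    refine ih g' hg' (mul_left_cancel₀ X_ne_zero ?_)
    rw [← pow_succ', ← h]
    ring

open PowerSeries in
/-- A factor of `X ^ N * C r` that is not divisible by any prime of the coefficient ring
is a factor of `X ^ N`. -/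
theorem exists_mul_eq_X_pow {F : Type*} [Field F] {f : PowerSeries (Polynomial F)}
    (hprim : ∀ p : Polynomial F, Prime p → ¬ C p ∣ f) (N : ℕ) (r : Polynomial F) (hr : r ≠ 0) :
    ∀ g ∈ degreeBounded F, f * g = X ^ N * C r → ∃ g' ∈ degreeBounded F, f * g' = X ^ N := by
  induction r using UniqueFactorizationMonoid.induction_on_prime with
  | h₁ => exact absurd rfl hr
  | h₂ r hu =>
    intro g hg h
    obtain ⟨c, hc, rfl⟩ := Polynomial.isUnit_iff.1 hu
    refine ⟨g * C (Polynomial.C c⁻¹), mul_mem hg fun s => ?_, ?_⟩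
    · rw [coeff_C]; split_ifs <;> simp
    · rw [← mul_assoc, h, mul_assoc, ← map_mul, ← map_mul, mul_inv_cancel₀ hc.ne_zero]
      simp
  | h₃ r p hr0 hp ih =>
    intro g hg h
    have hdvd : C p ∣ f * g := by
      rw [h, map_mul]
      exact (dvd_mul_right _ _).mul_left _
    obtain ⟨g', rfl⟩ := (C_dvd_or_dvd hp hdvd).resolve_left (hprim p hp)
    have hCp : (C p : PowerSeries (Polynomial F)) ≠ 0 := by
      exact (map_ne_zero_iff _ C_injective).2 hp.ne_zero
    refine ih hr0 g' (fun s => ?_) (mul_left_cancel₀ hCp ?_)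
    · by_cases hs : coeff s g' = 0
      · simp [hs]
      · refine le_trans ?_ (hg s)
        rw [coeff_C_mul]
        exact Polynomial.natDegree_le_of_dvd (dvd_mul_left _ _) (mul_ne_zero hp.ne_zero hs)
    · rw [map_mul] at h
      linear_combination h

open Polynomial in
/-- `k[x, y]` as the ring `k[x][y]` of polynomials in `y` over `k[x]`. -/
def toIterated (F : Type*) [Field F] : MvPolynomial (Fin 2) F ≃ₐ[F] F[X][X] :=
  AlgEquiv.ofAlgHom (MvPolynomial.aeval ![C X, X])
    (Polynomial.eval₂AlgHom (Polynomial.aeval (MvPolynomial.X 0)) (MvPolynomial.X 1)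
      fun _ => Commute.all _ _)
    (by
      ext <;> simp)
    (by
      ext i
      fin_cases i <;> simp)

theorem coeff_coeff_toIterated {F : Type*} [Field F] (p : MvPolynomial (Fin 2) F) (i j : ℕ) :
    ((toIterated F p).coeff j).coeff i =
      MvPolynomial.coeff (Finsupp.single 0 i + Finsupp.single 1 j) p := by
  classical
  induction p using MvPolynomial.induction_on' with
  | add p q hp hq => simp [hp, hq]
  | monomial u a =>
    have h1 : toIterated F (MvPolynomial.monomial u a) =
        Polynomial.monomial (u 1) (Polynomial.monomial (u 0) a) := by
      simp only [toIterated, AlgEquiv.ofAlgHom_apply, MvPolynomial.aeval_monomial]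
      rw [Finsupp.prod_fintype _ _ (by simp)]
      simp [← Polynomial.C_mul_X_pow_eq_monomial, ← mul_assoc, Polynomial.algebraMap_apply]
    have h2 : u = Finsupp.single 0 i + Finsupp.single 1 j ↔ u 0 = i ∧ u 1 = j := by
      simp [Finsupp.ext_iff, Fin.forall_fin_two]
    rw [h1, MvPolynomial.coeff_monomial, Polynomial.coeff_monomial]
    by_cases hj : u 1 = j <;> by_cases hi : u 0 = i <;>
      simp [h2, hi, hj, Polynomial.coeff_monomial]

theorem algebraMap_Kx (F : Type) [Field F] (a : F) :
    algebraMap F (Kx F) a = HahnSeries.C a := by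
  rw [HahnSeries.algebraMap_apply', PowerSeries.algebraMap_apply]
  simp

theorem algebraMap_Kxy (F : Type) [Field F] (a : F) :
    algebraMap F (Kxy F) a = HahnSeries.C (algebraMap F (Kx F) a) := by
  rw [HahnSeries.algebraMap_apply', PowerSeries.algebraMap_apply]
  simp

open Polynomial in
theorem polyX_injective (F : Type) [Field F] : Function.Injective (polyX F) := by
  rw [injective_iff_map_eq_zero]
  intro p hp
  ext n
  have h (p : F[X]) : (polyX F p).coeff (-(n : ℤ)) = p.coeff n := by
    induction p using Polynomial.induction_on' with
    | add p q hp hq => simp [hp, hq]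
    | monomial m a =>
      simp only [polyX, Polynomial.aeval_monomial, xInner, HahnSeries.single_pow, algebraMap_Kx,
        HahnSeries.C_mul_eq_smul, HahnSeries.coeff_smul, HahnSeries.coeff_single,
        Polynomial.coeff_monomial]
      simp [eq_comm]
  rw [← h, hp]; simp

/-- Laurent expansion of elements of `k[x][y]`. -/
def expandIterated (F : Type) [Field F] : Polynomial (Polynomial F) →+* Kxy F :=
  Polynomial.eval₂RingHom (HahnSeries.C.comp (polyX F : Polynomial F →+* Kx F)) (yElem F)

theorem expandIterated_toIterated (F : Type) [Field F] (p : MvPolynomial (Fin 2) F) :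
    expandIterated F (toIterated F p) = expand F p := by
  induction p using MvPolynomial.induction_on with
  | C a =>
    have h : polyX F (Polynomial.C a) = algebraMap F (Kx F) a := Polynomial.aeval_C _ _
    simp [expandIterated, toIterated, expand, Polynomial.algebraMap_apply, algebraMap_Kxy, h]
  | add p q hp hq => simp [hp, hq]
  | mul_X p i hp =>
    rw [map_mul, map_mul, map_mul, hp]
    congr 1
    fin_cases i <;> simp [expandIterated, toIterated, expand, xElem, polyX]

open Polynomial in
theorem coeff_expandIterated (F : Type) [Field F] (p : F[X][X]) (j : ℤ) :
    (expandIterated F p).coeff (-j) = polyX F (if 0 ≤ j then p.coeff j.toNat else 0) := by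
  induction p using Polynomial.induction_on' with
  | add p q hp hq =>
    rw [map_add, HahnSeries.coeff_add, hp, hq]
    split_ifs <;> simp
  | monomial m a =>
    simp only [expandIterated, Polynomial.coe_eval₂RingHom, Polynomial.eval₂_monomial, yElem,
      HahnSeries.single_pow, RingHom.comp_apply, HahnSeries.C_mul_eq_smul, HahnSeries.coeff_smul,
      HahnSeries.coeff_single, Polynomial.coeff_monomial]
    by_cases h : j = m
    · subst h
      simp
    · rw [if_neg (by simpa using h)]
      split_ifs with h1 h2
      · omega
      · simp
      · simp

/-- The embedding of `k[x]⟦Y⟧` into `k((x⁻¹))((y⁻¹))` with `Y = y⁻¹`. -/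
def powerSeriesEmb (F : Type) [Field F] : PowerSeries (Polynomial F) →+* Kxy F :=
  (HahnSeries.ofPowerSeries ℤ (Kx F)).comp
    (PowerSeries.map (polyX F : Polynomial F →+* Kx F))

theorem powerSeriesEmb_injective (F : Type) [Field F] :
    Function.Injective (powerSeriesEmb F) := by
  rw [powerSeriesEmb, RingHom.coe_comp]
  exact (HahnSeries.ofPowerSeries_injective (Γ := ℤ) (R := Kx F)).comp
    (PowerSeries.map_injective (polyX F : Polynomial F →+* Kx F) (polyX_injective F))

/-- An expansion `e = ∑ c_j y^j` with `c_j = 0` for `j > m`, divided by `y ^ m`. -/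
theorem powerSeriesEmb_mk (F : Type) [Field F] (e : Kxy F) (c : ℤ → Polynomial F)
    (hc : ∀ j, e.coeff (-j) = polyX F (c j)) (m : ℤ) (hm : ∀ j, m < j → c j = 0) :
    powerSeriesEmb F (PowerSeries.mk fun s => c (m - s)) = e * HahnSeries.single m 1 := by
  ext1
  funext i
  obtain ⟨j, rfl⟩ : ∃ j, i = -j + m := ⟨m - i, by ring⟩
  rw [HahnSeries.coeff_mul_single_add, mul_one, hc, powerSeriesEmb, RingHom.comp_apply,
    PowerSeries.coeff_coe]
  split_ifs with h
  · rw [hm j (by omega), map_zero]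
  · have : m - ((-j + m).natAbs : ℤ) = j := by omega
    rw [PowerSeries.coeff_map, PowerSeries.coeff_mk, this]
    rfl

/-- The power series `y⁻ᵈ p` in `Y = y⁻¹`, for `p` of degree at most `d` in `y`. -/
def homogenize {F : Type} [Field F] (d : ℕ) (p : Polynomial (Polynomial F)) :
    PowerSeries (Polynomial F) :=
  PowerSeries.mk fun s => if s ≤ d then p.coeff (d - s) else 0

theorem powerSeriesEmb_homogenize {F : Type} [Field F] {d : ℕ} {p : Polynomial (Polynomial F)}
    (h : p.natDegree ≤ d) :
    powerSeriesEmb F (homogenize d p) =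
      expandIterated F p * HahnSeries.single (d : ℤ) 1 := by
  rw [← powerSeriesEmb_mk F _ _ (coeff_expandIterated F p)]
  · congr 1
    ext1 s
    rw [homogenize, PowerSeries.coeff_mk, PowerSeries.coeff_mk]
    by_cases hs : s ≤ d
    · rw [if_pos hs, if_pos (by omega)]
      congr 1
      omega
    · rw [if_neg hs, if_neg (by omega)]
  · intro j hj
    rw [if_pos (by omega), Polynomial.coeff_eq_zero_of_natDegree_lt (by omega)]

theorem powerSeriesEmb_C (F : Type) [Field F] (r : Polynomial F) :
    powerSeriesEmb F (PowerSeries.C r) = expandIterated F (Polynomial.C r) := by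
  simp [powerSeriesEmb, expandIterated]

theorem powerSeriesEmb_X_pow (F : Type) [Field F] (n : ℕ) :
    powerSeriesEmb F (PowerSeries.X ^ n) = HahnSeries.single (n : ℤ) 1 := by
  rw [powerSeriesEmb, RingHom.comp_apply, map_pow, PowerSeries.map_X,
    HahnSeries.ofPowerSeries_X_pow]

/-- The total degree of `p ∈ k[x][y]` is at most `d`. -/
def TotalDegreeLE {F : Type} [Field F] (p : Polynomial (Polynomial F)) (d : ℕ) : Prop :=
  ∀ i j, d < i + j → (p.coeff j).coeff i = 0

theorem TotalDegreeLE.natDegree_le {F : Type} [Field F] {p : Polynomial (Polynomial F)} {d : ℕ}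
    (h : TotalDegreeLE p d) : p.natDegree ≤ d := by
  rw [Polynomial.natDegree_le_iff_coeff_eq_zero]
  intro j hj
  ext i
  simpa using h i j (by omega)

theorem TotalDegreeLE.homogenize_mem {F : Type} [Field F] {p : Polynomial (Polynomial F)} {d : ℕ}
    (h : TotalDegreeLE p d) : homogenize d p ∈ degreeBounded F := by
  intro s
  rw [homogenize, PowerSeries.coeff_mk]
  split_ifs with hs
  · rw [Polynomial.natDegree_le_iff_coeff_eq_zero]
    intro i hi
    exact h i _ (by omega)
  · simp

theorem TotalDegreeLE.mono {F : Type} [Field F] {p : Polynomial (Polynomial F)} {d e : ℕ}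
    (h : TotalDegreeLE p d) (hde : d ≤ e) : TotalDegreeLE p e :=
  fun i j hij => h i j (by omega)

theorem totalDegreeLE_toIterated {F : Type} [Field F] (p : MvPolynomial (Fin 2) F) :
    TotalDegreeLE (toIterated F p) p.totalDegree := by
  intro i j hij
  rw [coeff_coeff_toIterated]
  refine MvPolynomial.coeff_eq_zero_of_totalDegree_lt (hij.trans_le ?_)
  rw [← Finsupp.degree_apply]
  simp

theorem exists_totalDegreeLE {F : Type} [Field F] (p : Polynomial (Polynomial F)) :
    ∃ d, TotalDegreeLE p d := by
  obtain ⟨q, rfl⟩ := (toIterated F).surjective p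
  exact ⟨_, totalDegreeLE_toIterated q⟩

theorem expandIterated_injective (F : Type) [Field F] :
    Function.Injective (expandIterated F) := by
  rw [injective_iff_map_eq_zero]
  intro p hp
  ext1 j
  have h := coeff_expandIterated F p j
  rw [hp, HahnSeries.coeff_zero, if_pos (by omega), Int.toNat_natCast] at h
  rw [Polynomial.coeff_zero]
  exact (map_eq_zero_iff _ (polyX_injective F)).1 h.symm

theorem C_dvd_of_C_dvd_homogenize {F : Type} [Field F] {d : ℕ} {p : Polynomial (Polynomial F)}
    (h : p.natDegree ≤ d) {r : Polynomial F} (hr : PowerSeries.C r ∣ homogenize d p) :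
    Polynomial.C r ∣ p := by
  rw [Polynomial.C_dvd_iff_dvd_coeff]
  intro j
  by_cases hj : j ≤ d
  · have := (PowerSeries.C_dvd_iff_forall_dvd_coeff.1 hr) (d - j)
    rwa [homogenize, PowerSeries.coeff_mk, if_pos (by omega), Nat.sub_sub_self hj] at this
  · rw [Polynomial.coeff_eq_zero_of_natDegree_lt (by omega)]
    exact dvd_zero r

/-- The key step: the coefficient of `y ^ d`, `d` the total degree of `Q`, is a unit. -/
theorem isUnit_coeff_of_expansion {F : Type} [Field F] {p q : Polynomial (Polynomial F)} {d : ℕ}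
    (hqd : TotalDegreeLE q d) (hqd' : ∃ i j, i + j = d ∧ (q.coeff j).coeff i ≠ 0)
    (hpq : ∀ r, r ∣ p → r ∣ q → IsUnit r) (c : ℤ → Polynomial F)
    (hc : ∀ j : ℤ, (expandIterated F p * (expandIterated F q)⁻¹).coeff (-j) = polyX F (c j))
    (m : ℤ) (hA1 : ∀ j : ℤ, c j ≠ 0 → ((c j).natDegree : ℤ) + j ≤ m) :
    IsUnit (q.coeff d) := by
  have hq : q ≠ 0 := by
    rintro rfl
    obtain ⟨i, j, -, h⟩ := hqd'
    simp at h
  have hq' : expandIterated F q ≠ 0 := (map_ne_zero_iff _ (expandIterated_injective F)).2 hq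
  set e := expandIterated F p * (expandIterated F q)⁻¹
  have he : expandIterated F q * e = expandIterated F p := by
    rw [mul_comm, inv_mul_cancel_right₀ hq']
  obtain ⟨a, b, r, hr, hab⟩ := exists_mul_add_mul_eq_C hq fun r h1 h2 => hpq r h2 h1
  obtain ⟨dp, hdp⟩ := exists_totalDegreeLE p
  obtain ⟨da, hda⟩ := exists_totalDegreeLE a
  obtain ⟨db, hdb⟩ := exists_totalDegreeLE b
  -- a common bound for all the degrees involved
  obtain ⟨M, hmM, hdpM, hdaM, hdbM⟩ : ∃ M : ℕ, m ≤ M ∧ dp ≤ M ∧ da ≤ M ∧ db ≤ M :=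
    ⟨m.toNat + dp + da + db, by omega, by omega, by omega, by omega⟩
  replace hdp := hdp.mono (hdpM.trans (Nat.le_add_left M d))
  replace hda := hda.mono hdaM
  replace hdb := hdb.mono hdbM
  have hcM (j : ℤ) (hj : (M : ℤ) < j) : c j = 0 := by
    by_contra h
    have := hA1 j h
    omega
  set f : PowerSeries (Polynomial F) := PowerSeries.mk fun s => c (M - s)
  have hf : f ∈ degreeBounded F := by
    intro s
    rw [PowerSeries.coeff_mk]
    by_cases h : c (M - s) = 0
    · simp [h]
    · have := hA1 _ h
      omega
  have hfe : powerSeriesEmb F f = e * HahnSeries.single (M : ℤ) 1 :=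
    powerSeriesEmb_mk F e c hc M hcM
  have hX (u v : ℕ) : (HahnSeries.single ((u + v : ℕ) : ℤ) 1 : Kxy F) =
      HahnSeries.single (u : ℤ) 1 * HahnSeries.single (v : ℤ) 1 := by
    simp [HahnSeries.single_mul_single]
  have hQF : homogenize d q * f = homogenize (d + M) p := by
    apply powerSeriesEmb_injective
    rw [map_mul, powerSeriesEmb_homogenize hqd.natDegree_le, hfe,
      powerSeriesEmb_homogenize hdp.natDegree_le, ← he, hX]
    ring
  have hprim (s : Polynomial F) (hs : Prime s) : ¬ PowerSeries.C s ∣ homogenize d q := by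
    intro h
    refine hs.not_isUnit (Polynomial.isUnit_C.1 (hpq _ ?_ ?_))
    · exact C_dvd_of_C_dvd_homogenize hdp.natDegree_le (hQF ▸ h.mul_right f)
    · exact C_dvd_of_C_dvd_homogenize hqd.natDegree_le h
  have hXmem : (PowerSeries.X ^ M : PowerSeries (Polynomial F)) ∈ degreeBounded F := by
    intro s
    rw [PowerSeries.coeff_X_pow]
    split_ifs <;> simp
  have hQG : homogenize d q * (homogenize M a * PowerSeries.X ^ M + homogenize M b * f) =
      PowerSeries.X ^ (d + M + M) * PowerSeries.C r := by
    apply powerSeriesEmb_injective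
    rw [map_mul, map_add, map_mul, map_mul, map_mul, powerSeriesEmb_X_pow, powerSeriesEmb_X_pow,
      powerSeriesEmb_C, powerSeriesEmb_homogenize hqd.natDegree_le,
      powerSeriesEmb_homogenize hda.natDegree_le, powerSeriesEmb_homogenize hdb.natDegree_le,
      hfe, ← hab, map_add, map_mul, map_mul, ← he, hX, hX]
    ring
  obtain ⟨g, hg, hQg⟩ := exists_mul_eq_X_pow hprim _ r hr _
    (add_mem (mul_mem hda.homogenize_mem hXmem) (mul_mem hdb.homogenize_mem hf)) hQG
  have htop : topPart (homogenize d q) ≠ 0 := by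
    obtain ⟨i, j, rfl, hij⟩ := hqd'
    intro h
    apply hij
    have := congrArg (PowerSeries.coeff i) h
    simpa [topPart, homogenize] using this
  simpa [homogenize] using
    isUnit_coeff_zero_of_mul_eq_X_pow hqd.homogenize_mem htop _ g hg hQg

/-- Lemma `technical` of Kurke–Zheglov.
Let `P, Q ∈ k[x,y]` be relatively prime, `Q ≠ 0`.  If the Laurent expansion at
infinity of `P/Q` lies in `k[x]((y⁻¹))`, with coefficients `c_j ∈ k[x]` of `y^j`,
and satisfies condition `A₁` (`deg_x(c_j) + j ≤ m` for all `j`), then the leading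
coefficient of `Q` as a polynomial in `y` is a nonzero constant and
`deg_y Q = total degree of Q`. -/
theorem stmt_15
    (P Q : MvPolynomial (Fin 2) k)
    (hQ : Q ≠ 0)
    -- `P` and `Q` are relatively prime
    (hPQ : ∀ r : MvPolynomial (Fin 2) k, r ∣ P → r ∣ Q → IsUnit r)
    -- the expansion of `P/Q` lies in `k[x]((y⁻¹))`, with coefficients `c j` at `y^j`
    (c : ℤ → Polynomial k)
    (hc : ∀ j : ℤ, (expand k P * (expand k Q)⁻¹).coeff (-j) = polyX k (c j))
    -- condition `A₁`
    (m : ℤ)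
    (hA1 : ∀ j : ℤ, c j ≠ 0 → ((c j).natDegree : ℤ) + j ≤ m) :
    -- the leading coefficient `q_n` of `Q = ∑_{l=0}^n q_l(x) y^l` is a nonzero constant,
    (∀ mo : Fin 2 →₀ ℕ, mo 1 = Q.degreeOf 1 → mo 0 ≠ 0 → MvPolynomial.coeff mo Q = 0) ∧
    MvPolynomial.coeff (Finsupp.single 1 (Q.degreeOf 1)) Q ≠ 0 ∧
    -- and `n = deg_y Q` equals the total degree of `Q`
    Q.totalDegree = Q.degreeOf 1 := by
  have htd : ∃ i j, i + j = Q.totalDegree ∧ ((toIterated k Q).coeff j).coeff i ≠ 0 := by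
    obtain ⟨u, hu, hdeg⟩ := Finset.exists_mem_eq_sup Q.support
      (MvPolynomial.support_nonempty.2 hQ) fun u => u.sum fun _ e => e
    refine ⟨u 0, u 1, ?_, ?_⟩
    · rw [MvPolynomial.totalDegree, hdeg, Finsupp.sum_fintype _ _ (by simp), Fin.sum_univ_two]
    · rw [coeff_coeff_toIterated]
      have : u = Finsupp.single 0 (u 0) + Finsupp.single 1 (u 1) := by
        ext i
        fin_cases i <;> simp
      rw [← this]
      exact MvPolynomial.mem_support_iff.1 hu
  have hunit : IsUnit ((toIterated k Q).coeff Q.totalDegree) := by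
    refine isUnit_coeff_of_expansion (p := toIterated k P) (totalDegreeLE_toIterated Q) htd
      (fun r h1 h2 => ?_) c ?_ m hA1
    · obtain ⟨r, rfl⟩ := (toIterated k).surjective r
      exact (hPQ r ((map_dvd_iff (toIterated k)).1 h1)
        ((map_dvd_iff (toIterated k)).1 h2)).map (toIterated k)
    · simpa only [expandIterated_toIterated] using hc
  have hlead : MvPolynomial.coeff (Finsupp.single 1 Q.totalDegree) Q ≠ 0 := by
    obtain ⟨a, ha, ha'⟩ := Polynomial.isUnit_iff.1 hunit
    have h := coeff_coeff_toIterated Q 0 Q.totalDegree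
    rw [← ha', Polynomial.coeff_C_zero, Finsupp.single_zero, zero_add] at h
    exact h ▸ ha.ne_zero
  have hdeg : Q.totalDegree = Q.degreeOf 1 := by
    refine le_antisymm ?_ (MvPolynomial.degreeOf_le_totalDegree Q 1)
    simpa using MvPolynomial.monomial_le_degreeOf 1 (MvPolynomial.mem_support_iff.2 hlead)
  refine ⟨fun mo h1 h0 => MvPolynomial.coeff_eq_zero_of_totalDegree_lt ?_, hdeg ▸ hlead, hdeg⟩
  rw [← Finsupp.degree_apply, Finsupp.degree_eq_sum, Fin.sum_univ_two]
  omega
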